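/- Let M be a matroid of rank r on a ground set of size n and let C be a circuit of M with |C| = r + 1. Then the winning probability of C equals β_C = binom(n, r+1)^{-1}. -/

import Mathlib

open Finset

/-- A matroid presented by its collection of circuits (the valid sets of bingo
cards): nonempty ground set axioms (C1)-(C3) of the paper. -/
structure BingoMatroid (α : Type*) [DecidableEq α] where
  /-- the ground set -/
  E : Finset α
  /-- the circuits (bingo cards) -/
  circuits : Finset (Finset α)
  subset_ground : ∀ C ∈ circuits, C ⊆ E
  empty_not_mem : ∅ ∉ circuits
  antichain : ∀ C₁ ∈ circuits, ∀ C₂ ∈ circuits, C₁ ⊆ C₂ → C₁ = C₂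
  elimination : ∀ C₁ ∈ circuits, ∀ C₂ ∈ circuits, C₁ ≠ C₂ →
    ∀ e ∈ C₁ ∩ C₂, ∃ C₃ ∈ circuits, C₃ ⊆ (C₁ ∪ C₂) \ {e}

/-- The completion time `t_C(σ)`: the least `t` such that every element of `C`
has been called out among the first `t` values of `σ`. -/
noncomputable def hitTime {α : Type*} {n : ℕ} (σ : Fin n → α) (C : Finset α) : ℕ :=
  sInf {t : ℕ | ∀ x ∈ C, ∃ i : Fin n, (i : ℕ) < t ∧ σ i = x}

namespace BingoMatroid

variable {α : Type*} [DecidableEq α]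

/-- `C` wins the bingo game under calling order `σ`: it is completed strictly
before every other circuit. -/
def Wins (M : BingoMatroid α) (σ : Fin M.E.card ≃ {x // x ∈ M.E}) (C : Finset α) : Prop :=
  ∀ C' ∈ M.circuits, C' ≠ C →
    hitTime (fun i => (σ i : α)) C < hitTime (fun i => (σ i : α)) C'

/-- The winning probability `β_C`: the number of calling orders under which `C`
wins, divided by `n!`. -/
noncomputable def beta (M : BingoMatroid α) (C : Finset α) : ℚ :=
  (Nat.card {σ : Fin M.E.card ≃ {x // x ∈ M.E} // M.Wins σ C} : ℚ) /
    (Nat.factorial M.E.card : ℚ)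

/-- The timed winning probability `β_C(t)`: the probability that `C` wins and is
completed exactly in round `t`. -/
noncomputable def betaT (M : BingoMatroid α) (C : Finset α) (t : ℕ) : ℚ :=
  (Nat.card {σ : Fin M.E.card ≃ {x // x ∈ M.E} //
      M.Wins σ C ∧ hitTime (fun i => (σ i : α)) C = t} : ℚ) /
    (Nat.factorial M.E.card : ℚ)

/-- A set is independent if it is contained in the ground set and contains no circuit. -/
def Indep (M : BingoMatroid α) (I : Finset α) : Prop :=
  I ⊆ M.E ∧ ∀ C ∈ M.circuits, ¬ C ⊆ I

/-- The rank of the matroid: the maximum size of an independent set. -/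
noncomputable def rank (M : BingoMatroid α) : ℕ :=
  sSup {k : ℕ | ∃ I : Finset α, M.Indep I ∧ I.card = k}

/-- A basis is a maximal independent set. -/
def IsBase (M : BingoMatroid α) (B : Finset α) : Prop :=
  M.Indep B ∧ ∀ J : Finset α, M.Indep J → B ⊆ J → B = J

/-- A coloop is an element of the ground set contained in no circuit. -/
def IsColoop (M : BingoMatroid α) (e : α) : Prop :=
  e ∈ M.E ∧ ∀ C ∈ M.circuits, e ∉ C

/-- `D` is a circuit of the contraction `M/T`: a nonempty inclusion-minimal
member of `{C \ T : C a circuit of M}`. -/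
def IsContractCircuit (M : BingoMatroid α) (T D : Finset α) : Prop :=
  D.Nonempty ∧ (∃ C ∈ M.circuits, D = C \ T) ∧
    ∀ C' ∈ M.circuits, (C' \ T).Nonempty → ¬ (C' \ T) ⊂ D

end BingoMatroid

/-- Equivalences matching `p` with `q` amount to an equivalence between the subtypes of `p` and `q`
and an equivalence between their complements. -/
def equivPreservingEquivProd {α β : Type*} (p : α → Prop) (q : β → Prop)
    [DecidablePred p] [DecidablePred q] :
    {e : α ≃ β // ∀ a, p a ↔ q (e a)} ≃
      ({a // p a} ≃ {b // q b}) × ({a // ¬ p a} ≃ {b // ¬ q b}) where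
  toFun e := (e.1.subtypeEquiv e.2, e.1.subtypeEquiv fun a => not_congr (e.2 a))
  invFun f :=
    ⟨(Equiv.sumCompl p).symm.trans ((f.1.sumCongr f.2).trans (Equiv.sumCompl q)), fun a => by
      by_cases h : p a
      · simpa [h] using (f.1 ⟨a, h⟩).2
      · simpa [h] using (f.2 ⟨a, h⟩).2⟩
  left_inv e := by
    ext a
    by_cases h : p a <;> simp [h]
  right_inv f := by
    ext a
    · simp [a.2]
    · simp [a.2]

theorem card_equiv_preserving {α β : Type*} [Fintype α] [Fintype β] [DecidableEq α]
    [DecidableEq β] (p : α → Prop) (q : β → Prop) [DecidablePred p] [DecidablePred q]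
    (hαβ : Fintype.card α = Fintype.card β)
    (hpq : Fintype.card {a // p a} = Fintype.card {b // q b}) :
    Nat.card {e : α ≃ β // ∀ a, p a ↔ q (e a)} =
      (Fintype.card {b // q b}).factorial *
        (Fintype.card β - Fintype.card {b // q b}).factorial := by
  have hc : Fintype.card {a // ¬ p a} = Fintype.card {b // ¬ q b} := by
    rw [Fintype.card_subtype_compl, Fintype.card_subtype_compl, hαβ, hpq]
  rw [Nat.card_congr (equivPreservingEquivProd p q), Nat.card_prod, Nat.card_eq_fintype_card,
    Nat.card_eq_fintype_card, Fintype.card_equiv (Fintype.equivOfCardEq hpq),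
    Fintype.card_equiv (Fintype.equivOfCardEq hc), hc, hpq, Fintype.card_subtype_compl]

theorem hitTime_le_iff {α : Type*} {n : ℕ} {σ : Fin n → α} {C : Finset α}
    (h : ∀ x ∈ C, ∃ i, σ i = x) {t : ℕ} :
    hitTime σ C ≤ t ↔ ∀ x ∈ C, ∃ i : Fin n, (i : ℕ) < t ∧ σ i = x := by
  refine ⟨fun ht x hx => ?_, fun ht => Nat.sInf_le ht⟩
  have hne : {t : ℕ | ∀ x ∈ C, ∃ i : Fin n, (i : ℕ) < t ∧ σ i = x}.Nonempty :=
    ⟨n, fun x hx => (h x hx).imp fun i hi => ⟨i.2, hi⟩⟩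
  obtain ⟨i, hi, rfl⟩ := Nat.sInf_mem hne x hx
  exact ⟨i, hi.trans_le ht, rfl⟩

namespace BingoMatroid

variable {α : Type*} [DecidableEq α]

theorem Indep.card_le_rank {M : BingoMatroid α} {I : Finset α} (hI : M.Indep I) :
    I.card ≤ M.rank :=
  le_csSup ⟨M.E.card, by rintro _ ⟨J, hJ, rfl⟩; exact card_le_card hJ.1⟩ ⟨I, hI, rfl⟩

theorem exists_call_eq {M : BingoMatroid α} (σ : Fin M.E.card ≃ {x // x ∈ M.E})
    {C : Finset α} (hC : C ∈ M.circuits) : ∀ x ∈ C, ∃ i, (σ i : α) = x :=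
  fun x hx => ⟨σ.symm ⟨x, M.subset_ground C hC hx⟩, by simp⟩

/-- A circuit of size `r + 1` wins exactly when its elements are the first `r + 1` calls. -/
theorem wins_iff_of_card_eq_rank_add_one {M : BingoMatroid α} {C : Finset α}
    (hC : C ∈ M.circuits) (hcard : C.card = M.rank + 1)
    (σ : Fin M.E.card ≃ {x // x ∈ M.E}) :
    M.Wins σ C ↔ ∀ i : Fin M.E.card, (i : ℕ) < C.card ↔ (σ i : α) ∈ C := by
  constructor
  · intro hw
    set t := hitTime (fun i => (σ i : α)) C with ht
    have hinj : Function.Injective fun i => (σ i : α) :=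
      Subtype.val_injective.comp σ.injective
    have htn : t ≤ M.E.card := (hitTime_le_iff (exists_call_eq σ hC)).2 fun x hx =>
      (exists_call_eq σ hC x hx).imp fun i hi => ⟨i.2, hi⟩
    set T : Finset α :=
      (univ.filter fun i : Fin M.E.card => (i : ℕ) < t).image fun i => (σ i : α) with hT
    have hmem : ∀ x, x ∈ T ↔ ∃ i : Fin M.E.card, (i : ℕ) < t ∧ (σ i : α) = x := by
      simp [hT]
    have hTcard : T.card = t := by
      rw [hT, card_image_of_injective _ hinj, Fin.card_filter_val_lt, min_eq_right htn]
    have hsub : ∀ C' ∈ M.circuits, C' ⊆ T → C' = C := by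
      intro C' hC' hT'
      by_contra hne
      exact (hw C' hC' hne).not_ge ((hitTime_le_iff (exists_call_eq σ hC')).2
        fun x hx => (hmem x).1 (hT' hx))
    have hCT : C ⊆ T := fun x hx =>
      (hmem x).2 ((hitTime_le_iff (exists_call_eq σ hC)).1 ht.ge x hx)
    obtain ⟨e, he⟩ : C.Nonempty := card_pos.1 (by omega)
    have hI : M.Indep (T.erase e) := by
      refine ⟨fun x hx => ?_, fun C' hC' hT' => ?_⟩
      · obtain ⟨i, -, rfl⟩ := (hmem x).1 (mem_of_mem_erase hx)
        exact (σ i).2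
      · obtain rfl := hsub C' hC' (hT'.trans (erase_subset _ _))
        exact notMem_erase e T (hT' he)
    have hle := hI.card_le_rank
    rw [card_erase_of_mem (hCT he)] at hle
    have hCeq : C = T := eq_of_subset_of_card_le hCT (by omega)
    intro i
    rw [hCeq, hTcard, hmem]
    exact ⟨fun hi => ⟨i, hi, rfl⟩, fun ⟨j, hj, hji⟩ => hinj hji ▸ hj⟩
  · intro h C' hC' hne
    by_contra! hlt
    have hk : hitTime (fun i => (σ i : α)) C ≤ C.card :=
      (hitTime_le_iff (exists_call_eq σ hC)).2 fun x hx => by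
        obtain ⟨i, rfl⟩ := exists_call_eq σ hC x hx
        exact ⟨i, (h i).2 hx, rfl⟩
    refine hne (M.antichain C' hC' C hC fun x hx => ?_)
    obtain ⟨i, hi, rfl⟩ :=
      (hitTime_le_iff (exists_call_eq σ hC')).1 (hlt.trans hk) x hx
    exact (h i).1 hi

end BingoMatroid

/-- a circuit of maximum size `r + 1` has winning probability
exactly `binom(n, r+1)⁻¹`. -/
theorem stmt8 {α : Type*} [DecidableEq α] (M : BingoMatroid α) (hE : M.E.Nonempty)
    (C : Finset α) (hC : C ∈ M.circuits) (hcard : C.card = M.rank + 1) :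
    M.beta C = (Nat.choose M.E.card (M.rank + 1) : ℚ)⁻¹ := by
  have hle : C.card ≤ M.E.card := card_le_card (M.subset_ground C hC)
  have hp : Fintype.card {i : Fin M.E.card // (i : ℕ) < C.card} = C.card := by
    rw [Fintype.card_subtype, Fin.card_filter_val_lt, min_eq_right hle]
  have hq : Fintype.card {x : {x // x ∈ M.E} // (x : α) ∈ C} = C.card := by
    rw [Fintype.card_congr (Equiv.subtypeSubtypeEquivSubtype
      fun {x} hx => M.subset_ground C hC hx), Fintype.card_coe]
  have hcount := card_equiv_preserving (fun i : Fin M.E.card => (i : ℕ) < C.card)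
    (fun x : {x // x ∈ M.E} => (x : α) ∈ C) (by simp) (hp.trans hq.symm)
  rw [hq, Fintype.card_coe] at hcount
  rw [BingoMatroid.beta, ← hcard, Nat.card_congr (Equiv.subtypeEquivRight
    (BingoMatroid.wins_iff_of_card_eq_rank_add_one hC hcard)), hcount,
    Nat.cast_choose ℚ hle, inv_div, Nat.cast_mul]
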